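/- Let c^V(n) denote the number of compositions (c_1,…,c_t) of n such that c_{2i-1} = 1 for every odd index 2i−1 ≤ t and c_{2i} is odd and at least 3 for every even index 2i ≤ t. Then c^V(1) = 1, c^V(2) = 0, c^V(3) = 0, c^V(4) = 1, and c^V(n) = c^V(n−2) + c^V(n−4) for every n ≥ 5. -/

import Mathlib

/-- A composition of `n`: a list of positive integers summing to `n`. -/
def IsComposition (n : ℕ) (l : List ℕ) : Prop :=
  (∀ x ∈ l, 0 < x) ∧ l.sum = n

/-- Lists alternating between a part `1` and an odd part at least `3`, starting with `1`. -/
def IsAlternating : List ℕ → Prop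
  | [] => True
  | [a] => a = 1
  | a :: b :: l => a = 1 ∧ Odd b ∧ 3 ≤ b ∧ IsAlternating l

theorem isAlternating_iff (l : List ℕ) :
    IsAlternating l ↔ (∀ x ∈ l, 0 < x) ∧
      (∀ i : ℕ, 2 * i < l.length → l.getD (2 * i) 0 = 1) ∧
      (∀ i : ℕ, 2 * i + 1 < l.length →
        Odd (l.getD (2 * i + 1) 0) ∧ 3 ≤ l.getD (2 * i + 1) 0) := by
  induction l using IsAlternating.induct with
  | case1 => simp [IsAlternating]
  | case2 a =>
    constructor
    · rintro rfl
      refine ⟨by simp, fun i hi => ?_, fun i hi => ?_⟩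
      · obtain rfl : i = 0 := by simp at hi; omega
        rfl
      · simp at hi
    · exact fun h => h.2.1 0 (by simp)
  | case3 a b l ih =>
    rw [IsAlternating, ih]
    constructor
    · rintro ⟨rfl, hb, hb3, hpos, heven, hodd⟩
      refine ⟨?_, fun i hi => ?_, fun i hi => ?_⟩
      · simp only [List.mem_cons, forall_eq_or_imp]
        exact ⟨by omega, by omega, hpos⟩
      · cases i with
        | zero => rfl
        | succ i => exact heven i (by simp at hi; omega)
      · cases i with
        | zero => exact ⟨hb, hb3⟩
        | succ i => exact hodd i (by simp at hi; omega)
    · rintro ⟨hpos, heven, hodd⟩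
      refine ⟨heven 0 (by simp), (hodd 0 (by simp)).1, (hodd 0 (by simp)).2,
        fun x hx => hpos x (by simp [hx]), fun i hi => ?_, fun i hi => ?_⟩
      · exact heven (i + 1) (by simp; omega)
      · exact hodd (i + 1) (by simp; omega)

/-- The alternating lists with sum `n`. -/
def alternatingLists (n : ℕ) : Set (List ℕ) :=
  {l | IsAlternating l ∧ l.sum = n}

theorem finite_alternatingLists (n : ℕ) : (alternatingLists n).Finite := by
  refine (Set.finite_range (Composition.blocks (n := n))).subset ?_
  rintro l ⟨hl, hsum⟩
  exact ⟨⟨l, fun {i} hi => ((isAlternating_iff l).1 hl).1 i hi, hsum⟩, rfl⟩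

theorem alternatingLists_one : alternatingLists 1 = {[1]} := by
  ext l
  rcases l with _ | ⟨a, _ | ⟨b, l⟩⟩ <;> simp [alternatingLists, IsAlternating]
  omega

theorem alternatingLists_two : alternatingLists 2 = ∅ := by
  ext l
  rcases l with _ | ⟨a, _ | ⟨b, l⟩⟩ <;> simp [alternatingLists, IsAlternating] <;> omega

theorem alternatingLists_three : alternatingLists 3 = ∅ := by
  ext l
  rcases l with _ | ⟨a, _ | ⟨b, l⟩⟩ <;> simp [alternatingLists, IsAlternating] <;> omega

theorem IsAlternating.eq_nil_of_sum_eq_zero {l : List ℕ} (hl : IsAlternating l)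
    (hsum : l.sum = 0) : l = [] := by
  rcases l with _ | ⟨a, _ | ⟨b, l⟩⟩ <;> simp_all [IsAlternating]

theorem alternatingLists_four : alternatingLists 4 = {[1, 3]} := by
  ext l
  rcases l with _ | ⟨a, _ | ⟨b, l⟩⟩
  · simp [alternatingLists]
  · simp [alternatingLists, IsAlternating]
    omega
  · simp only [alternatingLists, IsAlternating, Set.mem_ofPred_eq, List.sum_cons,
      Set.mem_singleton_iff, List.cons.injEq]
    constructor
    · rintro ⟨⟨rfl, -, hb, hl⟩, hsum⟩
      exact ⟨rfl, by omega, hl.eq_nil_of_sum_eq_zero (by omega)⟩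
    · rintro ⟨rfl, rfl, rfl⟩
      exact ⟨⟨rfl, by decide, le_rfl, trivial⟩, rfl⟩

/-- Add `2` to the second entry of a list, if there is one. -/
def addTwoSnd : List ℕ → List ℕ
  | a :: b :: l => a :: (b + 2) :: l
  | l => l

theorem addTwoSnd_injective : Function.Injective addTwoSnd := by
  rintro (_ | ⟨a, _ | ⟨b, l⟩⟩) (_ | ⟨a', _ | ⟨b', l'⟩⟩) h <;> simp_all [addTwoSnd]

theorem alternatingLists_add_five (n : ℕ) :
    alternatingLists (n + 5) = addTwoSnd '' alternatingLists (n + 3) ∪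
      (fun l => 1 :: 3 :: l) '' alternatingLists (n + 1) := by
  ext l
  constructor
  · rintro ⟨hl, hsum⟩
    rcases l with _ | ⟨a, _ | ⟨b, l⟩⟩
    · simp at hsum
    · simp [IsAlternating] at hl hsum
      omega
    · obtain ⟨rfl, hb, hb3, hl⟩ := hl
      simp only [List.sum_cons] at hsum
      obtain ⟨k, rfl⟩ := hb
      obtain rfl | hk : k = 1 ∨ 2 ≤ k := by omega
      · exact Or.inr ⟨l, ⟨hl, by omega⟩, rfl⟩
      · obtain ⟨k, rfl⟩ := Nat.exists_eq_add_of_le' hk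
        refine Or.inl ⟨1 :: (2 * (k + 1) + 1) :: l,
          ⟨⟨rfl, odd_two_mul_add_one _, by omega, hl⟩, ?_⟩, rfl⟩
        simp only [List.sum_cons]
        omega
  · rintro (⟨l, ⟨hl, hsum⟩, rfl⟩ | ⟨l, ⟨hl, hsum⟩, rfl⟩)
    · rcases l with _ | ⟨a, _ | ⟨b, l⟩⟩
      · simp at hsum
      · simp [IsAlternating] at hl hsum
        omega
      · obtain ⟨rfl, hb, hb3, hl⟩ := hl
        simp only [List.sum_cons] at hsum
        refine ⟨⟨rfl, hb.add_even even_two, by omega, hl⟩, ?_⟩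
        simp only [addTwoSnd, List.sum_cons]
        omega
    · refine ⟨⟨rfl, by decide, le_rfl, hl⟩, ?_⟩
      simp only [List.sum_cons]
      omega

theorem disjoint_addTwoSnd_image (m n : ℕ) :
    Disjoint (addTwoSnd '' alternatingLists m)
      ((fun l => 1 :: 3 :: l) '' alternatingLists n) := by
  rw [Set.disjoint_left]
  rintro _ ⟨l, ⟨hl, -⟩, rfl⟩ ⟨l', -, h⟩
  rcases l with _ | ⟨a, _ | ⟨b, l⟩⟩
  · simp [addTwoSnd] at h
  · simp [addTwoSnd] at h
  · simp only [addTwoSnd, List.cons.injEq] at h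
    have := hl.2.2.1
    omega

theorem ncard_alternatingLists_add_five (n : ℕ) :
    (alternatingLists (n + 5)).ncard =
      (alternatingLists (n + 3)).ncard + (alternatingLists (n + 1)).ncard := by
  rw [alternatingLists_add_five, Set.ncard_union_eq (disjoint_addTwoSnd_image _ _)
      ((finite_alternatingLists _).image _) ((finite_alternatingLists _).image _),
    Set.ncard_image_of_injective _ addTwoSnd_injective,
    Set.ncard_image_of_injective _ fun l l' h => by simpa using h]

/-- `cV n` is the number of compositions of `n` whose parts in odd positions
(1-based) all equal `1` and whose parts in even positions (1-based) are all
odd and at least `3`. -/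
theorem cV_recurrence (cV : ℕ → ℕ)
    (hcV : ∀ n : ℕ, cV n = Nat.card {l : List ℕ // IsComposition n l ∧
      (∀ i : ℕ, 2 * i < l.length → l.getD (2 * i) 0 = 1) ∧
      (∀ i : ℕ, 2 * i + 1 < l.length →
        Odd (l.getD (2 * i + 1) 0) ∧ 3 ≤ l.getD (2 * i + 1) 0)}) :
    cV 1 = 1 ∧ cV 2 = 0 ∧ cV 3 = 0 ∧ cV 4 = 1 ∧
      ∀ n : ℕ, 5 ≤ n → cV n = cV (n - 2) + cV (n - 4) := by
  have hcard (n : ℕ) : cV n = (alternatingLists n).ncard := by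
    rw [hcV, ← Nat.card_coe_set_eq]
    refine Nat.card_congr (Equiv.subtypeEquivRight fun l => ?_)
    rw [alternatingLists, Set.mem_ofPred_eq, isAlternating_iff, IsComposition]
    tauto
  simp only [hcard]
  refine ⟨by simp [alternatingLists_one], by simp [alternatingLists_two],
    by simp [alternatingLists_three], by simp [alternatingLists_four], fun n hn => ?_⟩
  obtain ⟨n, rfl⟩ := Nat.exists_eq_add_of_le' hn
  exact ncard_alternatingLists_add_five n
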